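/- Fix a vertex a ≠ 0 and write a_i := p^i(a) (so a_0 = a, a_{d(a)} = 0). For all 0 ≤ j < n ≤ d(a), the second moment of the hitting time of a_n starting from a_j satisfies E[(T^{a_j}_{a_n})²] = Σ_{k=j}^{n−1} (2/(μ_{a_k}·π(a_k)))·( Σ_{b∈B_{a_k}} π(B_b)²/(μ_b·π(b)) + π(B_{a_k})·E[T^{a_{k+1}}_{a_n}] ) − E[T^{a_j}_{a_n}]. -/

import Mathlib

open MeasureTheory ProbabilityTheory Filter Topology ENNReal

noncomputable section

/-- A discrete-time birth-and-death chain on a countable rooted tree `I`.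
The tree is encoded by a root, a parent map and a depth function; the chain is
encoded by its transition matrix `P` (nonzero only between tree-neighbours and
on the diagonal) and by the laws `law x` of the trajectories started at `x`,
characterised by the cylinder formula.  `invm` is the reversible invariant
probability measure of the chain (positive recurrence). -/
structure TreeChain (I : Type*) [MeasurableSpace I] where
  root : I
  par : I → I
  depth : I → ℕ
  par_root : par root = root
  depth_root : depth root = 0
  depth_eq_zero : ∀ x, depth x = 0 → x = root
  depth_par : ∀ x, x ≠ root → depth x = depth (par x) + 1
  P : I → I → ℝ≥0∞
  P_row : ∀ x, ∑' y, P x y = 1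
  P_support : ∀ x y, P x y ≠ 0 → y = x ∨ y = par x ∨ x = par y
  lam_pos : ∀ x, x ≠ root → P (par x) x ≠ 0
  mu_pos : ∀ x, x ≠ root → P x (par x) ≠ 0
  law : I → Measure (ℕ → I)
  law_prob : ∀ x, IsProbabilityMeasure (law x)
  law_start : ∀ x, law x {ω | ω 0 = x} = 1
  law_cyl : ∀ x (n : ℕ) (γ : ℕ → I), γ 0 = x →
    law x {ω | ∀ i ≤ n, ω i = γ i} = ∏ i ∈ Finset.range n, P (γ i) (γ (i + 1))
  invm : I → ℝ≥0∞
  invm_pos : ∀ x, invm x ≠ 0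
  invm_sum : ∑' x, invm x = 1
  invm_rev : ∀ x y, invm x * P x y = invm y * P y x

/-- The hitting time of `y`, as an extended nonnegative real (`∞` if `y` is never hit). -/
def hitTime {I : Type*} (y : I) (ω : ℕ → I) : ℝ≥0∞ :=
  ⨅ (t : ℕ) (_ : ω t = y), (t : ℝ≥0∞)

namespace TreeChain

variable {I : Type*} [MeasurableSpace I] (c : TreeChain I)

/-- The branch `B_x` stemming from `x`: the set of descendants of `x` (including `x`). -/
def branch (x : I) : Set I := {y | ∃ n, c.par^[n] y = x}

/-- The set `ℓ(x)` of vertices on the path from `x` to the root, the root excluded. -/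
def pathToRoot (x : I) : Set I := {y | ∃ i < c.depth x, c.par^[i] x = y}

/-- The set `σ(x)` of children of `x`. -/
def children (x : I) : Set I := {y | y ≠ c.root ∧ c.par y = x}

/-- `μ_x`, the transition probability from `x` to its parent. -/
def mu (x : I) : ℝ≥0∞ := c.P x (c.par x)

/-- `λ_x`, the transition probability from the parent of `x` to `x`. -/
def lamP (x : I) : ℝ≥0∞ := c.P (c.par x) x

/-- `π(A)`, the invariant mass of a set of vertices. -/
def piSet (A : Set I) : ℝ≥0∞ := ∑' y : A, c.invm (y : I)

/-- `E[T^x_y]`, the expected hitting time of `y` for the chain started at `x`. -/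
def ET (x y : I) : ℝ≥0∞ := ∫⁻ ω, hitTime y ω ∂(c.law x)

/-- `E[(T^x_y)²]`, the second moment of the hitting time of `y` started at `x`. -/
def ET2 (x y : I) : ℝ≥0∞ := ∫⁻ ω, (hitTime y ω) ^ 2 ∂(c.law x)

/-- The normalised hitting time `T^x_y / E[T^x_y]` as a real random variable. -/
def ratio (x y : I) (ω : ℕ → I) : ℝ := (hitTime y ω).toReal / (c.ET x y).toReal

/-- `α(a)`: the child of the root lying on the path from `a` to the root. -/
def alphaVert (a : I) : I := c.par^[c.depth a - 1] a

/-- The drift constant `K_a = sup_{b ∈ B_{α(a)}} μ_b · E[T^b_{p(b)}]`. -/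
def Kdrift (a : I) : ℝ≥0∞ :=
  ⨆ b ∈ c.branch (c.alphaVert a), c.mu b * c.ET b (c.par b)

/-- The global constant `K'_a = sup_{b ∈ I} μ_b · E[T^b_{p(b)}]`. -/
def Kdrift' : ℝ≥0∞ := ⨆ b : I, c.mu b * c.ET b (c.par b)

/-- The quantity `Q_x = π(B_x)⁻¹ · Σ_{b ∈ B_x} π(B_b)²/(μ_b π(b))`. -/
def Qx (x : I) : ℝ≥0∞ :=
  (c.piSet (c.branch x))⁻¹ *
    ∑' b : c.branch x, (c.piSet (c.branch (b : I))) ^ 2 / (c.mu (b : I) * c.invm (b : I))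

/-- `Q_a = sup_{x ∈ ℓ(a)} Q_x`. -/
def Qsup (a : I) : ℝ≥0∞ := ⨆ x ∈ c.pathToRoot a, c.Qx x

/-- `R_a = Σ_{b ∈ ℓ(a)} π(B_b)²/(μ_b π(b))`. -/
def Rsum (a : I) : ℝ≥0∞ :=
  ∑' b : c.pathToRoot a, (c.piSet (c.branch (b : I))) ^ 2 / (c.mu (b : I) * c.invm (b : I))

/-- The set `C_{a,k}`: union over the vertices `a_l`, `k < l ≤ d(a)`, of the path from
`a_k` to the root, of the branches stemming from the children of `a_l` other
than `a_{l-1}`. -/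
def Cset (a : I) (k : ℕ) : Set I :=
  {y | ∃ l, k + 1 ≤ l ∧ l ≤ c.depth a ∧
    ∃ ch, ch ∈ c.children (c.par^[l] a) ∧ ch ≠ c.par^[l - 1] a ∧ y ∈ c.branch ch}

end TreeChain

/-- The strong drift condition `0^ℓ-SD` toward the root, for a family of chains
`c n` with distinguished vertices `a n` (the limit `a → ∞` being `n → ∞`). -/
def StrongDrift {I : ℕ → Type*} [∀ n, MeasurableSpace (I n)]
    (c : ∀ n, TreeChain (I n)) (a : ∀ n, I n) : Prop :=
  (∃ Kmu : ℝ≥0∞, 0 < Kmu ∧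
      ∀ n, ∀ b ∈ (c n).branch ((c n).alphaVert (a n)), Kmu ≤ (c n).mu b) ∧
  Tendsto (fun n => ((c n).Kdrift (a n)) ^ 2 / (c n).ET (a n) (c n).root) atTop (𝓝 0)


namespace TreeChain

variable {I : Type*} [MeasurableSpace I] (c : TreeChain I)

/-! ### Combinatorics of the tree -/

lemma depth_par_eq (x : I) : c.depth (c.par x) = c.depth x - 1 := by
  by_cases h : x = c.root
  · subst h; rw [c.par_root, c.depth_root]
  · rw [c.depth_par x h]; omega

lemma depth_iterate (n : ℕ) (x : I) : c.depth (c.par^[n] x) = c.depth x - n := by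
  induction n with
  | zero => rfl
  | succ n ih => rw [Function.iterate_succ_apply', depth_par_eq, ih]; omega

lemma ne_root_of_depth_pos {x : I} (h : 0 < c.depth x) : x ≠ c.root := by
  rintro rfl; rw [c.depth_root] at h; omega

lemma mem_branch_iff {w x : I} :
    w ∈ c.branch x ↔ c.depth x ≤ c.depth w ∧ c.par^[c.depth w - c.depth x] w = x := by
  refine ⟨?_, fun h => ⟨_, h.2⟩⟩
  rintro ⟨n, rfl⟩
  rw [depth_iterate]
  refine ⟨by omega, ?_⟩
  rcases le_total n (c.depth w) with h | h
  · congr 2; omega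
  · have h1 := c.depth_eq_zero (c.par^[n] w) (by rw [depth_iterate]; omega)
    rw [h1]
    exact c.depth_eq_zero _ (by rw [depth_iterate]; omega)

lemma depth_le_of_mem_branch {w x : I} (h : w ∈ c.branch x) : c.depth x ≤ c.depth w :=
  (c.mem_branch_iff.1 h).1

lemma self_mem_branch (x : I) : x ∈ c.branch x := ⟨0, rfl⟩

lemma mem_branch_trans {w b x : I} (h : w ∈ c.branch b) (h' : b ∈ c.branch x) :
    w ∈ c.branch x := by
  obtain ⟨n, rfl⟩ := h
  obtain ⟨k, rfl⟩ := h'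
  exact ⟨k + n, Function.iterate_add_apply _ _ _ _⟩

lemma mem_branch_iff_eq_or_par {x b : I} : x ∈ c.branch b ↔ x = b ∨ c.par x ∈ c.branch b := by
  constructor
  · rintro ⟨n, h⟩
    cases n with
    | zero => exact Or.inl h
    | succ n => exact Or.inr ⟨n, h⟩
  · rintro (rfl | ⟨n, h⟩)
    · exact c.self_mem_branch _
    · exact ⟨n + 1, h⟩

lemma par_notMem_branch {x : I} (h : x ≠ c.root) : c.par x ∉ c.branch x := fun h' => by
  have h1 := c.depth_le_of_mem_branch h'
  have h2 := c.depth_par x h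
  omega

lemma eq_of_mem_branch_of_depth_eq {w x y : I} (hx : w ∈ c.branch x) (hy : w ∈ c.branch y)
    (h : c.depth x = c.depth y) : x = y := by
  rw [mem_branch_iff] at hx hy
  rw [← hx.2, ← hy.2, h]

lemma exists_child_of_mem_branch {w x : I} (h : w ∈ c.branch x) (hne : w ≠ x) :
    ∃ y ∈ c.children x, w ∈ c.branch y := by
  obtain ⟨h1, h2⟩ := c.mem_branch_iff.1 h
  obtain ⟨k, hk⟩ : ∃ k, c.depth w - c.depth x = k + 1 := by
    refine Nat.exists_eq_succ_of_ne_zero fun h0 => hne ?_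
    simpa [h0] using h2
  refine ⟨c.par^[k] w, ⟨c.ne_root_of_depth_pos ?_, ?_⟩, ⟨k, rfl⟩⟩
  · rw [depth_iterate]; omega
  · rw [← Function.iterate_succ_apply' c.par, ← h2, hk]

lemma depth_of_mem_children {x y : I} (h : y ∈ c.children x) : c.depth y = c.depth x + 1 := by
  rw [c.depth_par y h.1, h.2]

lemma mem_branch_of_mem_children {x y : I} (h : y ∈ c.children x) : y ∈ c.branch x :=
  ⟨1, h.2⟩

open Classical in
lemma indicator_branch (g : I → ℝ≥0∞) (x w : I) :
    (c.branch x).indicator g w = (if w = x then g w else 0) +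
      ∑' y, if y ∈ c.children x then (c.branch y).indicator g w else 0 := by
  by_cases hw : w ∈ c.branch x
  · rw [Set.indicator_of_mem hw]
    by_cases hx : w = x
    · rw [if_pos hx, ENNReal.tsum_eq_zero.2, add_zero]
      intro y
      split_ifs with hy
      · refine Set.indicator_of_notMem (fun h => ?_) _
        have h1 := c.depth_le_of_mem_branch h
        rw [c.depth_of_mem_children hy, hx] at h1
        omega
      · rfl
    · obtain ⟨y, hy, hwy⟩ := c.exists_child_of_mem_branch hw hx
      rw [if_neg hx, zero_add, tsum_eq_single y, if_pos hy, Set.indicator_of_mem hwy]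
      intro y' hne
      split_ifs with hy'
      · refine Set.indicator_of_notMem (fun h => hne ?_) _
        exact c.eq_of_mem_branch_of_depth_eq h hwy
          (by rw [c.depth_of_mem_children hy, c.depth_of_mem_children hy'])
      · rfl
  · rw [Set.indicator_of_notMem hw, if_neg (fun h : w = x => hw (h ▸ c.self_mem_branch w)), zero_add,
      eq_comm, ENNReal.tsum_eq_zero]
    intro y
    split_ifs with hy
    · exact Set.indicator_of_notMem
        (fun h => hw (c.mem_branch_trans h (c.mem_branch_of_mem_children hy))) _
    · rfl

/-! ### The explicit potential operator -/

/-- The sum `Σ_{w ∈ B_x} π(w) f(w)`. -/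
def branchSum (f : I → ℝ≥0∞) (x : I) : ℝ≥0∞ :=
  ∑' w, (c.branch x).indicator (fun w => c.invm w * f w) w

/-- The increment at `x` of the potential of `f` along the path to the root. -/
def slope (f : I → ℝ≥0∞) (x : I) : ℝ≥0∞ := c.branchSum f x / (c.mu x * c.invm x)

open Classical in
/-- The potential of `f` for the chain killed on reaching depth `m`. -/
def potential (m : ℕ) (f : I → ℝ≥0∞) (x : I) : ℝ≥0∞ :=
  ∑' b, if m < c.depth b ∧ x ∈ c.branch b then c.slope f b else 0

open Classical in
lemma branchSum_eq (f : I → ℝ≥0∞) (x : I) :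
    c.branchSum f x = c.invm x * f x +
      ∑' y, if y ∈ c.children x then c.branchSum f y else 0 := by
  unfold branchSum
  simp_rw [c.indicator_branch (fun w => c.invm w * f w) x]
  rw [ENNReal.tsum_add, ENNReal.tsum_comm, tsum_ite_eq]
  congr 1
  refine tsum_congr fun y => ?_
  split_ifs <;> simp

lemma invm_le_one (x : I) : c.invm x ≤ 1 := c.invm_sum ▸ ENNReal.le_tsum x

lemma invm_ne_top (x : I) : c.invm x ≠ ∞ := ne_top_of_le_ne_top one_ne_top (c.invm_le_one x)

lemma P_le_one (x y : I) : c.P x y ≤ 1 := c.P_row x ▸ ENNReal.le_tsum y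

lemma P_ne_top (x y : I) : c.P x y ≠ ∞ := ne_top_of_le_ne_top one_ne_top (c.P_le_one x y)

lemma branchSum_ne_top {f : I → ℝ≥0∞} (hf : ∀ x, f x ≤ 1) (x : I) : c.branchSum f x ≠ ∞ := by
  refine ne_top_of_le_ne_top one_ne_top ?_
  rw [← c.invm_sum]
  refine ENNReal.tsum_le_tsum fun w => (Set.indicator_le_self' (fun _ _ => zero_le) w).trans ?_
  exact mul_le_of_le_one_right' (hf w)

lemma slope_ne_top {f : I → ℝ≥0∞} (hf : ∀ x, f x ≤ 1) {x : I} (hx : x ≠ c.root) :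
    c.slope f x ≠ ∞ :=
  ENNReal.div_ne_top (c.branchSum_ne_top hf x) (mul_ne_zero (c.mu_pos x hx) (c.invm_pos x))

lemma potential_eq_zero {m : ℕ} (f : I → ℝ≥0∞) {x : I} (hx : c.depth x ≤ m) :
    c.potential m f x = 0 := by
  refine ENNReal.tsum_eq_zero.2 fun b => if_neg fun h => ?_
  have := c.depth_le_of_mem_branch h.2
  omega

lemma potential_eq {m : ℕ} (f : I → ℝ≥0∞) {x : I} (hx : m < c.depth x) :
    c.potential m f x = c.potential m f (c.par x) + c.slope f x := by
  classical
  unfold potential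
  rw [← tsum_ite_eq x (fun b => c.slope f b), ← ENNReal.tsum_add]
  refine tsum_congr fun b => ?_
  have hp := c.par_notMem_branch (c.ne_root_of_depth_pos (by omega : 0 < c.depth x))
  by_cases hb : b = x
  · subst hb; simp [hx, hp, c.self_mem_branch]
  · simp [c.mem_branch_iff_eq_or_par (x := x), hb, Ne.symm hb]

lemma potential_ne_top (m : ℕ) {f : I → ℝ≥0∞} (hf : ∀ x, f x ≤ 1) (x : I) :
    c.potential m f x ≠ ∞ := by
  induction h : c.depth x using Nat.strong_induction_on generalizing x with
  | _ d ih =>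
    by_cases hx : m < c.depth x
    · rw [c.potential_eq f hx]
      have h0 := c.ne_root_of_depth_pos (by omega : 0 < c.depth x)
      exact ENNReal.add_ne_top.2
        ⟨ih _ (by rw [← h, c.depth_par x h0]; omega) _ rfl, c.slope_ne_top hf h0⟩
    · rw [c.potential_eq_zero f (by omega)]
      exact zero_ne_top

open Classical in
lemma mu_mul_slope (f : I → ℝ≥0∞) {x : I} (hx : x ≠ c.root) :
    c.P x (c.par x) * c.slope f x =
      f x + ∑' y, if y ∈ c.children x then c.P x y * c.slope f y else 0 := by
  have key : ∀ y, y ≠ c.root → c.invm y * (c.P y (c.par y) * c.slope f y) = c.branchSum f y := by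
    intro y hy
    rw [← mul_assoc, mul_comm (c.invm y)]
    exact ENNReal.mul_div_cancel (mul_ne_zero (c.mu_pos y hy) (c.invm_pos y))
      (ENNReal.mul_ne_top (c.P_ne_top _ _) (c.invm_ne_top y))
  refine (ENNReal.mul_right_inj (c.invm_pos x) (c.invm_ne_top x)).1 ?_
  rw [key x hx, branchSum_eq, mul_add, ← ENNReal.tsum_mul_left]
  congr 1
  refine tsum_congr fun y => ?_
  split_ifs with hy
  · rw [← key y hy.1, ← mul_assoc, ← mul_assoc, c.invm_rev x y, hy.2]
  · simp

lemma potential_poisson {m : ℕ} {f : I → ℝ≥0∞} (hf : ∀ x, f x ≤ 1) {x : I}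
    (hx : m < c.depth x) :
    c.potential m f x = f x + ∑' y, c.P x y * c.potential m f y := by
  classical
  have h0 := c.ne_root_of_depth_pos (by omega : 0 < c.depth x)
  have hd := c.depth_par x h0
  have hfin : c.P x (c.par x) * c.slope f x ≠ ∞ :=
    ENNReal.mul_ne_top (c.P_ne_top _ _) (c.slope_ne_top hf h0)
  have key : ∑' y, c.P x y * c.potential m f y + c.P x (c.par x) * c.slope f x =
      c.potential m f x + ∑' y, if y ∈ c.children x then c.P x y * c.slope f y else 0 := by
    conv_rhs => rw [← one_mul (c.potential m f x), ← c.P_row x, ← ENNReal.tsum_mul_right]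
    rw [← tsum_ite_eq (c.par x) (fun y => c.P x y * c.slope f x), ← ENNReal.tsum_add,
      ← ENNReal.tsum_add]
    refine tsum_congr fun y => ?_
    by_cases hP : c.P x y = 0
    · simp [hP]
    by_cases hy : y = c.par x
    · have : y ∉ c.children x := fun h => by
        have := c.depth_of_mem_children h
        rw [hy] at this
        omega
      rw [if_pos hy, if_neg this, add_zero, hy, c.potential_eq f hx, mul_add]
    · rw [if_neg hy, add_zero]
      by_cases hyc : y ∈ c.children x
      · rw [if_pos hyc, c.potential_eq f (x := y) (by rw [c.depth_of_mem_children hyc]; omega),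
          hyc.2, mul_add]
      · have : y = x := by
          rcases c.P_support x y hP with h | h | h
          · exact h
          · exact absurd h hy
          · by_contra hne
            refine hyc ⟨?_, h.symm⟩
            rintro rfl
            exact h0 (h.trans c.par_root)
        rw [if_neg hyc, add_zero, this]
  rw [c.mu_mul_slope f h0, ← add_assoc] at key
  have hfin' : (∑' y, if y ∈ c.children x then c.P x y * c.slope f y else 0) ≠ ∞ := by
    rw [c.mu_mul_slope f h0] at hfin
    exact (ENNReal.add_ne_top.1 hfin).2
  rw [← (ENNReal.add_left_inj hfin').1 key, add_comm]

/-! ### The killed chain -/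

open Classical in
/-- The transition operator of the chain killed on reaching depth `m`. -/
def killed (m : ℕ) (f : I → ℝ≥0∞) (x : I) : ℝ≥0∞ :=
  if m < c.depth x then ∑' y, c.P x y * f y else 0

/-- The restriction of a function to the vertices of depth greater than `m`. -/
def above (m : ℕ) (f : I → ℝ≥0∞) : I → ℝ≥0∞ := {x | m < c.depth x}.indicator f

lemma killed_tsum {ι : Type*} (m : ℕ) (F : ι → I → ℝ≥0∞) :
    c.killed m (fun x => ∑' i, F i x) = fun x => ∑' i, c.killed m (F i) x := by
  funext x
  unfold killed
  split_ifs
  · simp_rw [← ENNReal.tsum_mul_left]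
    exact ENNReal.tsum_comm
  · simp

lemma killed_iterate_tsum {ι : Type*} (m N : ℕ) (F : ι → I → ℝ≥0∞) :
    (c.killed m)^[N] (fun x => ∑' i, F i x) = fun x => ∑' i, (c.killed m)^[N] (F i) x := by
  induction N generalizing F with
  | zero => rfl
  | succ N ih => simp_rw [Function.iterate_succ_apply, killed_tsum, ih]

lemma killed_add (m : ℕ) (f g : I → ℝ≥0∞) :
    c.killed m (f + g) = c.killed m f + c.killed m g := by
  funext x
  simp only [killed, Pi.add_apply]
  split_ifs
  · simp_rw [mul_add, ENNReal.tsum_add]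
  · simp

lemma killed_iterate_add (m N : ℕ) (f g : I → ℝ≥0∞) :
    (c.killed m)^[N] (f + g) = (c.killed m)^[N] f + (c.killed m)^[N] g := by
  induction N generalizing f g with
  | zero => rfl
  | succ N ih => simp_rw [Function.iterate_succ_apply, killed_add, ih]

lemma killed_const_mul (m : ℕ) (r : ℝ≥0∞) (f : I → ℝ≥0∞) :
    c.killed m (fun x => r * f x) = fun x => r * c.killed m f x := by
  funext x
  unfold killed
  split_ifs
  · simp_rw [← ENNReal.tsum_mul_left, mul_left_comm]
  · simp

lemma killed_iterate_const_mul (m N : ℕ) (r : ℝ≥0∞) (f : I → ℝ≥0∞) :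
    (c.killed m)^[N] (fun x => r * f x) = fun x => r * (c.killed m)^[N] f x := by
  induction N generalizing f with
  | zero => rfl
  | succ N ih => simp_rw [Function.iterate_succ_apply, killed_const_mul, ih]

lemma killed_mono (m : ℕ) : Monotone (c.killed m) := by
  intro f g h x
  unfold killed
  split_ifs
  · exact ENNReal.tsum_le_tsum fun y => mul_le_mul_right (h y) _
  · exact le_rfl

lemma potential_eq_above_add_killed (m : ℕ) {f : I → ℝ≥0∞} (hf : ∀ x, f x ≤ 1) :
    c.potential m f = c.above m f + c.killed m (c.potential m f) := by
  funext x
  by_cases hx : m < c.depth x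
  · simpa [above, killed, hx] using c.potential_poisson hf hx
  · simp [above, killed, hx, c.potential_eq_zero f (not_lt.1 hx)]

lemma potential_eq_sum_add (m : ℕ) {f : I → ℝ≥0∞} (hf : ∀ x, f x ≤ 1) (N : ℕ) (x : I) :
    c.potential m f x = ∑ s ∈ Finset.range N, (c.killed m)^[s] (c.above m f) x +
      (c.killed m)^[N] (c.potential m f) x := by
  induction N with
  | zero => simp
  | succ N ih =>
    rw [ih, Finset.sum_range_succ, add_assoc]
    congr 1
    conv_lhs => rw [c.potential_eq_above_add_killed m hf, killed_iterate_add]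
    rfl

lemma tendsto_killed_iterate (m : ℕ) (x : I) :
    Tendsto (fun N => (c.killed m)^[N] (c.above m 1) x) atTop (𝓝 0) := by
  refine ENNReal.tendsto_atTop_zero_of_tsum_ne_top
    (ne_top_of_le_ne_top (c.potential_ne_top m (f := 1) (fun _ => le_rfl) x) ?_)
  rw [ENNReal.tsum_eq_iSup_nat]
  refine iSup_le fun N => ?_
  rw [c.potential_eq_sum_add m (f := 1) (fun _ => le_rfl) N x]
  exact le_self_add

lemma potential_eq_tsum_of_bounded (m : ℕ) {f : I → ℝ≥0∞} (hf : ∀ x, f x ≤ 1) {C : ℝ≥0∞}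
    (hC : C ≠ ∞) (hb : ∀ x, c.potential m f x ≤ C) (x : I) :
    c.potential m f x = ∑' s, (c.killed m)^[s] (c.above m f) x := by
  have hle : c.potential m f ≤ fun x => C * c.above m 1 x := by
    intro x
    by_cases hx : m < c.depth x
    · simpa [above, hx] using hb x
    · simp [c.potential_eq_zero f (not_lt.1 hx)]
  have h0 : Tendsto (fun N => (c.killed m)^[N] (c.potential m f) x) atTop (𝓝 0) := by
    refine tendsto_of_tendsto_of_tendsto_of_le_of_le tendsto_const_nhds ?_
      (fun _ => zero_le) (fun N => (c.killed_mono m).iterate N hle x)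
    simp_rw [killed_iterate_const_mul]
    simpa using ENNReal.Tendsto.const_mul (c.tendsto_killed_iterate m x) (Or.inr hC)
  have h1 := (ENNReal.tendsto_nat_tsum
    (fun s => (c.killed m)^[s] (c.above m f) x)).add h0
  simp_rw [← c.potential_eq_sum_add m hf _ x, add_zero] at h1
  exact tendsto_nhds_unique tendsto_const_nhds h1

lemma branchSum_tsum {ι : Type*} (F : ι → I → ℝ≥0∞) (x : I) :
    c.branchSum (fun w => ∑' i, F i w) x = ∑' i, c.branchSum (F i) x := by
  unfold branchSum
  rw [ENNReal.tsum_comm]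
  refine tsum_congr fun w => ?_
  by_cases h : w ∈ c.branch x <;> simp [h, ENNReal.tsum_mul_left]

lemma branchSum_const_mul (r : ℝ≥0∞) (f : I → ℝ≥0∞) (x : I) :
    c.branchSum (fun w => r * f w) x = r * c.branchSum f x := by
  unfold branchSum
  rw [← ENNReal.tsum_mul_left]
  refine tsum_congr fun w => ?_
  by_cases h : w ∈ c.branch x <;> simp [h, mul_left_comm]

lemma potential_tsum {ι : Type*} (m : ℕ) (F : ι → I → ℝ≥0∞) (x : I) :
    c.potential m (fun w => ∑' i, F i w) x = ∑' i, c.potential m (F i) x := by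
  unfold potential
  rw [ENNReal.tsum_comm]
  refine tsum_congr fun b => ?_
  split_ifs
  · simp_rw [slope, branchSum_tsum, div_eq_mul_inv, ENNReal.tsum_mul_right]
  · simp

lemma potential_const_mul (m : ℕ) (r : ℝ≥0∞) (f : I → ℝ≥0∞) (x : I) :
    c.potential m (fun w => r * f w) x = r * c.potential m f x := by
  unfold potential
  rw [← ENNReal.tsum_mul_left]
  refine tsum_congr fun b => ?_
  split_ifs
  · rw [slope, slope, branchSum_const_mul, mul_div_assoc]
  · simp

open Classical in
lemma potential_single_le (m : ℕ) (w x : I) :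
    c.potential m (fun y => if y = w then 1 else 0) x ≤
      c.potential m (fun y => if y = w then 1 else 0) w := by
  refine ENNReal.tsum_le_tsum fun b => ?_
  by_cases hw : w ∈ c.branch b
  · simp only [hw, and_true]
    split_ifs with h1 h2 h2
    · exact le_rfl
    · exact absurd h1.1 h2
    · exact zero_le
    · exact le_rfl
  · have : c.slope (fun y => if y = w then 1 else 0) b = 0 := by
      rw [slope, branchSum, ENNReal.tsum_eq_zero.2, ENNReal.zero_div]
      intro y
      by_cases hy : y = w
      · subst hy; simp [hw]
      · by_cases hyb : y ∈ c.branch b <;> simp [hyb, hy]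
    simp [this]

/-- The explicit potential is the Green operator of the killed chain. -/
lemma potential_eq_tsum (m : ℕ) (f : I → ℝ≥0∞) (x : I) :
    c.potential m f x = ∑' s, (c.killed m)^[s] (c.above m f) x := by
  classical
  have hf : f = fun y => ∑' w, f w * (if y = w then 1 else 0) := by
    funext y
    simp_rw [mul_ite, mul_one, mul_zero]
    exact (tsum_ite_eq' y f).symm
  have ha : c.above m f =
      fun y => ∑' w, f w * c.above m (fun y => if y = w then 1 else 0) y := by
    funext y
    by_cases hy : m < c.depth y
    · simp [above, hy]
    · simp [above, hy]
  rw [ha]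
  simp_rw [killed_iterate_tsum, killed_iterate_const_mul]
  rw [ENNReal.tsum_comm]
  conv_lhs => rw [hf, potential_tsum]
  refine tsum_congr fun w => ?_
  have h1 : ∀ y : I, (if y = w then 1 else 0 : ℝ≥0∞) ≤ 1 := fun y => by split_ifs <;> simp
  rw [potential_const_mul, c.potential_eq_tsum_of_bounded m h1 (c.potential_ne_top m h1 w)
    (c.potential_single_le m w), ENNReal.tsum_mul_left]

lemma above_potential (m : ℕ) (f : I → ℝ≥0∞) : c.above m (c.potential m f) = c.potential m f := by
  funext x
  by_cases hx : m < c.depth x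
  · simp [above, hx]
  · simp [above, hx, c.potential_eq_zero f (not_lt.1 hx)]

/-- The iterated potential of the constant function `1`. -/
lemma potential_potential_one (m : ℕ) (x : I) :
    c.potential m (c.potential m 1) x =
      ∑' s, ∑' t, (c.killed m)^[s + t] (c.above m 1) x := by
  rw [potential_eq_tsum, above_potential]
  refine tsum_congr fun s => ?_
  have : c.potential m 1 = fun x => ∑' t, (c.killed m)^[t] (c.above m 1) x :=
    funext fun x => c.potential_eq_tsum m 1 x
  rw [this, killed_iterate_tsum]
  simp_rw [Function.iterate_add_apply]

lemma potential_eq_sum_Ico (f : I → ℝ≥0∞) (a : I) {j n : ℕ} (hjn : j ≤ n)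
    (hn : n ≤ c.depth a) :
    c.potential (c.depth (c.par^[n] a)) f (c.par^[j] a) =
      ∑ k ∈ Finset.Ico j n, c.slope f (c.par^[k] a) := by
  induction hjn using Nat.decreasingInduction with
  | self => simp [c.potential_eq_zero f le_rfl]
  | of_succ k hk ih =>
    rw [c.potential_eq f (by rw [depth_iterate, depth_iterate]; omega),
      ← Function.iterate_succ_apply' c.par, ih, Finset.sum_eq_sum_Ico_succ_bot hk, add_comm]

lemma branchSum_one (x : I) : c.branchSum 1 x = c.piSet (c.branch x) := by
  simp [branchSum, piSet, tsum_subtype]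

open Classical in
lemma potential_eq_add_of_mem_branch {m : ℕ} (f : I → ℝ≥0∞) {x w : I} (hx : m < c.depth x)
    (hw : w ∈ c.branch x) :
    c.potential m f w = c.potential m f (c.par x) +
      ∑' b, if b ∈ c.branch x ∧ w ∈ c.branch b then c.slope f b else 0 := by
  unfold potential
  rw [← ENNReal.tsum_add]
  refine tsum_congr fun b => ?_
  have hx0 := c.ne_root_of_depth_pos (by omega : 0 < c.depth x)
  by_cases hwb : w ∈ c.branch b
  · by_cases hb : b ∈ c.branch x
    · have h1 := c.depth_le_of_mem_branch hb
      have h2 : c.par x ∉ c.branch b := fun h =>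
        c.par_notMem_branch hx0 (c.mem_branch_trans h hb)
      simp [hwb, hb, h2, hx.trans_le h1]
    · have h2 : c.par x ∈ c.branch b := by
        have hxb : x ∈ c.branch b := by
          obtain ⟨n, hn⟩ := hw
          obtain ⟨k, hk⟩ := hwb
          rcases le_total n k with h | h
          · exact ⟨k - n, by rw [← hn, ← Function.iterate_add_apply, Nat.sub_add_cancel h, hk]⟩
          · exact absurd ⟨n - k, by
              rw [← hk, ← Function.iterate_add_apply, Nat.sub_add_cancel h, hn]⟩ hb
        rcases c.mem_branch_iff_eq_or_par.1 hxb with h | h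
        · exact absurd (h ▸ c.self_mem_branch x) hb
        · exact h
      simp [hwb, hb, h2]
  · have h2 : c.par x ∉ c.branch b := fun h =>
      hwb (c.mem_branch_trans hw (c.mem_branch_iff_eq_or_par.2 (Or.inr h)))
    simp [hwb, h2]

lemma branchSum_potential_one {m : ℕ} {x : I} (hx : m < c.depth x) :
    c.branchSum (c.potential m 1) x =
      (∑' b : c.branch x,
        (c.piSet (c.branch (b : I))) ^ 2 / (c.mu (b : I) * c.invm (b : I))) +
      c.piSet (c.branch x) * c.potential m 1 (c.par x) := by
  classical
  have h : ∀ w, (c.branch x).indicator (fun w => c.invm w * c.potential m 1 w) w =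
      (∑' b, (c.branch x).indicator
        (fun b => (c.branch b).indicator c.invm w * c.slope 1 b) b) +
      (c.branch x).indicator c.invm w * c.potential m 1 (c.par x) := by
    intro w
    by_cases hw : w ∈ c.branch x
    · rw [Set.indicator_of_mem hw, Set.indicator_of_mem hw,
        c.potential_eq_add_of_mem_branch 1 hx hw, mul_add, add_comm, ← ENNReal.tsum_mul_left]
      congr 1
      refine tsum_congr fun b => ?_
      by_cases hb : b ∈ c.branch x <;> by_cases hwb : w ∈ c.branch b <;> simp [hb, hwb]
    · rw [Set.indicator_of_notMem hw, Set.indicator_of_notMem hw, zero_mul, add_zero, eq_comm,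
        ENNReal.tsum_eq_zero]
      intro b
      by_cases hb : b ∈ c.branch x
      · have : w ∉ c.branch b := fun h => hw (c.mem_branch_trans h hb)
        simp [this]
      · simp [hb]
  rw [branchSum, tsum_congr h, ENNReal.tsum_add, ENNReal.tsum_mul_right, ENNReal.tsum_comm,
    piSet, tsum_subtype, tsum_subtype (c.branch x) (fun b => (c.piSet (c.branch b)) ^ 2 /
      (c.mu b * c.invm b))]
  congr 1
  refine tsum_congr fun b => ?_
  by_cases hb : b ∈ c.branch x
  · simp only [hb, Set.indicator_of_mem]
    rw [ENNReal.tsum_mul_right, slope, branchSum_one, piSet, tsum_subtype, sq, mul_div_assoc]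
  · simp [hb]

/-! ### Measurability of the path space -/

lemma mem_measurableAtom_saturated {T : Set (ℕ → I)} (hT : MeasurableSet T) {ω ω' : ℕ → I}
    (h : ∀ i, ω' i ∈ measurableAtom (ω i)) (hω : ω ∈ T) : ω' ∈ T := by
  have hle : (MeasurableSpace.pi : MeasurableSpace (ℕ → I)) ≤
      { MeasurableSet' := fun T => (ω ∈ T ↔ ω' ∈ T)
        measurableSet_empty := by simp
        measurableSet_compl := fun s hs => by simp [hs]
        measurableSet_iUnion := fun s hs => by simp [hs] } := by
    refine iSup_le fun i => ?_
    rintro _ ⟨s, hs, rfl⟩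
    refine ⟨fun h1 => mem_of_mem_measurableAtom (h i) hs h1, fun h1 => ?_⟩
    by_contra h2
    exact mem_of_mem_measurableAtom (h i) hs.compl h2 h1
  exact (hle T hT).1 hω

lemma law_atom (x y : I) :
    c.law x {ω | ω 0 ∈ measurableAtom x ∧ ω 1 ∈ measurableAtom y} = c.P x y := by
  classical
  have hcyl := c.law_cyl x 1 (fun i => if i = 0 then x else y) rfl
  have hset : {ω : ℕ → I | ∀ i ≤ 1, ω i = if i = 0 then x else y} =
      {ω | ω 0 = x ∧ ω 1 = y} := by
    ext ω
    constructor
    · intro h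
      exact ⟨by simpa using h 0 (by simp), by simpa using h 1 le_rfl⟩
    · rintro ⟨h0, h1⟩ i hi
      interval_cases i <;> simp [h0, h1]
  rw [hset] at hcyl
  simp only [Finset.range_one, Finset.prod_singleton, if_true, zero_add, one_ne_zero,
    if_false] at hcyl
  refine le_antisymm ?_ ?_
  · rw [← hcyl, ← measure_toMeasurable {ω : ℕ → I | ω 0 = x ∧ ω 1 = y}]
    refine measure_mono fun ω hω => ?_
    let ω₀ : ℕ → I := fun i => if i = 0 then x else if i = 1 then y else ω i
    have hω₀ : ω₀ ∈ toMeasurable (c.law x) {ω : ℕ → I | ω 0 = x ∧ ω 1 = y} :=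
      subset_toMeasurable _ _ ⟨by simp [ω₀], by simp [ω₀]⟩
    refine mem_measurableAtom_saturated (measurableSet_toMeasurable _ _) (fun i => ?_) hω₀
    by_cases h0 : i = 0
    · subst h0; simpa [ω₀] using hω.1
    by_cases h1 : i = 1
    · subst h1; simpa [ω₀] using hω.2
    simp [ω₀, h0, h1]
  · rw [← hcyl]
    refine measure_mono fun ω hω => ?_
    obtain ⟨h0, h1⟩ := hω
    exact ⟨h0 ▸ mem_measurableAtom_self _, h1 ▸ mem_measurableAtom_self _⟩

lemma measurableAtom_eq_singleton [Countable I] {x y : I} (hP : c.P x y ≠ 0) : measurableAtom y = {y} := by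
  classical
  refine Set.Subset.antisymm (fun y' hy' => ?_) (by simp)
  by_contra hne
  have hne : y' ≠ y := hne
  have hatom : measurableAtom y' = measurableAtom y := measurableAtom_eq_of_mem hy'
  have hPy : c.P x y' = c.P x y := by rw [← law_atom, ← law_atom, hatom]
  have hle : (1 : ℝ≥0∞) ≤ ∑' z, if z = y' then 0 else c.P x z := by
    rw [← c.law_start x]
    calc c.law x {ω | ω 0 = x}
        ≤ c.law x (⋃ z, if z = y' then ∅ else
            {ω | ω 0 ∈ measurableAtom x ∧ ω 1 ∈ measurableAtom z}) := by
          refine measure_mono fun ω hω => ?_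
          have h0 : ω 0 ∈ measurableAtom x := by
            rw [show ω 0 = x from hω]; exact mem_measurableAtom_self x
          by_cases h1 : ω 1 = y'
          · refine Set.mem_iUnion.2 ⟨y, ?_⟩
            rw [if_neg hne.symm]
            exact ⟨h0, h1 ▸ hy'⟩
          · refine Set.mem_iUnion.2 ⟨ω 1, ?_⟩
            rw [if_neg h1]
            exact ⟨h0, mem_measurableAtom_self _⟩
      _ ≤ _ := by
          refine (measure_iUnion_le _).trans (ENNReal.tsum_le_tsum fun z => ?_)
          split_ifs
          · simp
          · rw [law_atom]
  have hsum : c.P x y' + ∑' z, (if z = y' then 0 else c.P x z) = 1 := by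
    rw [← c.P_row x]
    exact (ENNReal.tsum_eq_add_tsum_ite y').symm
  have h2 : c.P x y' + 1 ≤ 0 + 1 := by
    rw [zero_add]; exact (add_le_add_right hle _).trans hsum.le
  have h3 := (ENNReal.add_le_add_iff_right one_ne_top).1 h2
  exact hP (hPy ▸ le_antisymm h3 zero_le)

/-- The cylinder formula forces points to be measurable. -/
lemma measurableSingletonClass [Countable I] {a : I} (ha : a ≠ c.root) : MeasurableSingletonClass I := by
  refine ⟨fun y => ?_⟩
  have h : ∃ x, c.P x y ≠ 0 := by
    by_cases hy : y = c.root
    · have hd : 0 < c.depth a := Nat.pos_of_ne_zero fun h => ha (c.depth_eq_zero a h)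
      refine ⟨c.par^[c.depth a - 1] a, ?_⟩
      have h1 : c.par (c.par^[c.depth a - 1] a) = c.root := by
        refine c.depth_eq_zero _ ?_
        rw [← Function.iterate_succ_apply' c.par, depth_iterate]
        omega
      have h2 := c.mu_pos (c.par^[c.depth a - 1] a)
        (c.ne_root_of_depth_pos (by rw [depth_iterate]; omega))
      rwa [h1, ← hy] at h2
    · exact ⟨_, c.lam_pos y hy⟩
  obtain ⟨x, hx⟩ := h
  rw [← c.measurableAtom_eq_singleton hx]
  exact MeasurableSet.measurableAtom_of_countable y

/-! ### Hitting times -/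

/-- The trajectories which have not visited `z` up to time `N`. -/
def avoid (z : I) (N : ℕ) : Set (ℕ → I) := {ω | ∀ i ≤ N, ω i ≠ z}

lemma depth_lt_of_mem_branch {z x : I} (hx : x ∈ c.branch z) (hne : x ≠ z) :
    c.depth z < c.depth x := by
  refine lt_of_le_of_ne (c.depth_le_of_mem_branch hx) fun h => hne ?_
  exact c.eq_of_mem_branch_of_depth_eq (c.self_mem_branch x) hx h.symm

lemma mem_branch_of_P_ne_zero {z x y : I} (hx : x ∈ c.branch z) (hne : x ≠ z)
    (hP : c.P x y ≠ 0) : y ∈ c.branch z := by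
  rcases c.P_support x y hP with rfl | rfl | rfl
  · exact hx
  · exact (c.mem_branch_iff_eq_or_par.1 hx).resolve_left hne
  · exact c.mem_branch_iff_eq_or_par.2 (Or.inr hx)

lemma measurableSet_apply_eq [MeasurableSingletonClass I] (i : ℕ) (y : I) :
    MeasurableSet {ω : ℕ → I | ω i = y} :=
  (measurable_pi_apply i : Measurable fun ω : ℕ → I => ω i) (measurableSet_singleton y)

lemma measurableSet_avoid [MeasurableSingletonClass I] (z : I) (N : ℕ) :
    MeasurableSet (avoid z N) := by
  simp only [avoid, Set.ofPred_forall]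
  exact .iInter fun i => .iInter fun _ => (measurableSet_apply_eq i z).compl

lemma law_prefix_avoid [Countable I] [MeasurableSingletonClass I] (z : I) (N n : ℕ)
    (γ : ℕ → I) (hγ : γ n ∈ c.branch z) :
    c.law (γ 0) {ω | (∀ i ≤ n, ω i = γ i) ∧ ∀ i ≤ N, ω (n + i) ≠ z} =
      (∏ i ∈ Finset.range n, c.P (γ i) (γ (i + 1))) *
        (c.killed (c.depth z))^[N] (c.above (c.depth z) 1) (γ n) := by
  induction N generalizing n γ with
  | zero =>
    by_cases hz : γ n = z
    · have : {ω : ℕ → I | (∀ i ≤ n, ω i = γ i) ∧ ∀ i ≤ 0, ω (n + i) ≠ z} = ∅ := by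
        refine Set.eq_empty_of_forall_notMem fun ω hω => hω.2 0 le_rfl ?_
        rw [← hz]; exact hω.1 n le_rfl
      rw [this, measure_empty]
      simp [above, hz]
    · have : {ω : ℕ → I | (∀ i ≤ n, ω i = γ i) ∧ ∀ i ≤ 0, ω (n + i) ≠ z} =
          {ω | ∀ i ≤ n, ω i = γ i} := by
        ext ω
        refine ⟨fun h => h.1, fun h => ⟨h, fun i hi => ?_⟩⟩
        rw [Nat.le_zero.1 hi, add_zero, h n le_rfl]
        exact hz
      rw [this, c.law_cyl _ n γ rfl]
      simp [above, c.depth_lt_of_mem_branch hγ hz]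
  | succ N ih =>
    rw [Function.iterate_succ_apply']
    by_cases hz : γ n = z
    · have : {ω : ℕ → I | (∀ i ≤ n, ω i = γ i) ∧ ∀ i ≤ N + 1, ω (n + i) ≠ z} = ∅ := by
        refine Set.eq_empty_of_forall_notMem fun ω hω => hω.2 0 (Nat.zero_le _) ?_
        rw [← hz]; exact hω.1 n le_rfl
      rw [this, measure_empty]
      simp [killed, hz]
    · let γ' : I → ℕ → I := fun y => Function.update γ (n + 1) y
      have hγ' : ∀ y, ∀ i ≤ n, γ' y i = γ i := fun y i hi =>
        Function.update_of_ne (by omega) _ _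
      have hγn : ∀ y, γ' y (n + 1) = y := fun y => Function.update_self _ _ _
      have hset : {ω : ℕ → I | (∀ i ≤ n, ω i = γ i) ∧ ∀ i ≤ N + 1, ω (n + i) ≠ z} =
          ⋃ y, {ω | (∀ i ≤ n + 1, ω i = γ' y i) ∧ ∀ i ≤ N, ω (n + 1 + i) ≠ z} := by
        ext ω
        simp only [Set.mem_iUnion, Set.mem_ofPred_eq]
        constructor
        · rintro ⟨h1, h2⟩
          refine ⟨ω (n + 1), fun i hi => ?_, fun i hi => ?_⟩
          · rcases Nat.le_succ_iff.1 hi with h | rfl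
            · rw [hγ' _ i h, h1 i h]
            · rw [hγn]
          · rw [add_assoc, add_comm 1]
            exact h2 (i + 1) (by omega)
        · rintro ⟨y, h1, h2⟩
          have h1' : ∀ i ≤ n, ω i = γ i := fun i hi => by rw [h1 i (by omega), hγ' y i hi]
          refine ⟨h1', fun i hi => ?_⟩
          cases i with
          | zero => rw [add_zero, h1' n le_rfl]; exact hz
          | succ i =>
            have := h2 i (by omega)
            rwa [add_assoc, add_comm 1] at this
      have hmeas : ∀ y, MeasurableSet
          {ω : ℕ → I | (∀ i ≤ n + 1, ω i = γ' y i) ∧ ∀ i ≤ N, ω (n + 1 + i) ≠ z} := by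
        intro y
        simp only [Set.ofPred_and, Set.ofPred_forall]
        exact (MeasurableSet.iInter fun i => .iInter fun _ => measurableSet_apply_eq i _).inter
          (.iInter fun i => .iInter fun _ => (measurableSet_apply_eq (n + 1 + i) z).compl)
      have hdisj : Pairwise (Function.onFun Disjoint fun y =>
          {ω : ℕ → I | (∀ i ≤ n + 1, ω i = γ' y i) ∧ ∀ i ≤ N, ω (n + 1 + i) ≠ z}) := by
        intro y y' hne
        refine Set.disjoint_left.2 fun ω h h' => hne ?_
        rw [← hγn y, ← hγn y', ← h.1 _ le_rfl, h'.1 _ le_rfl]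
      rw [hset, measure_iUnion hdisj hmeas, killed, if_pos (c.depth_lt_of_mem_branch hγ hz),
        ← ENNReal.tsum_mul_left]
      refine tsum_congr fun y => ?_
      have h0 : γ 0 = γ' y 0 := (hγ' y 0 (Nat.zero_le _)).symm
      have hprod : ∏ i ∈ Finset.range (n + 1), c.P (γ' y i) (γ' y (i + 1)) =
          (∏ i ∈ Finset.range n, c.P (γ i) (γ (i + 1))) * c.P (γ n) y := by
        rw [Finset.prod_range_succ, hγn, hγ' y n le_rfl]
        congr 1
        refine Finset.prod_congr rfl fun i hi => ?_
        have := Finset.mem_range.1 hi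
        rw [hγ' y i (by omega), hγ' y (i + 1) (by omega)]
      by_cases hP : c.P (γ n) y = 0
      · rw [hP, zero_mul, mul_zero, ← nonpos_iff_eq_zero]
        refine (measure_mono (fun ω hω => hω.1 :
          _ ⊆ {ω : ℕ → I | ∀ i ≤ n + 1, ω i = γ' y i})).trans ?_
        rw [c.law_cyl _ (n + 1) (γ' y) h0.symm, hprod, hP, mul_zero]
      · rw [h0, ih (n + 1) (γ' y)
          (by rw [hγn]; exact c.mem_branch_of_P_ne_zero hγ hz hP), hprod, hγn, mul_assoc]

lemma law_avoid [Countable I] [MeasurableSingletonClass I] {x z : I} (hx : x ∈ c.branch z)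
    (N : ℕ) :
    c.law x (avoid z N) = (c.killed (c.depth z))^[N] (c.above (c.depth z) 1) x := by
  have := c.law_prob x
  have h := c.law_prefix_avoid z N 0 (fun _ => x) hx
  rw [Finset.range_zero, Finset.prod_empty, one_mul] at h
  rw [← h]
  have hae : {ω : ℕ → I | ω 0 = x} ∈ ae (c.law x) :=
    (mem_ae_iff_prob_eq_one (measurableSet_apply_eq 0 x)).2 (c.law_start x)
  refine measure_congr ?_
  filter_upwards [hae] with ω hω
  refine propext ⟨fun h => ⟨fun i hi => ?_, fun i hi => ?_⟩, fun h i hi => ?_⟩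
  · rw [Nat.le_zero.1 hi]; exact hω
  · rw [zero_add]; exact h i hi
  · have := h.2 i hi
    rwa [zero_add] at this

lemma hitTime_cases {J : Type*} (z : J) (ω : ℕ → J) :
    (hitTime z ω = ∞ ∧ ∀ N, ω ∈ avoid z N) ∨
      ∃ n : ℕ, hitTime z ω = n ∧ ∀ N, ω ∈ avoid z N ↔ N < n := by
  classical
  by_cases h : ∃ t, ω t = z
  · refine Or.inr ⟨Nat.find h, le_antisymm (iInf₂_le (Nat.find h) (Nat.find_spec h)) ?_, fun N => ?_⟩
    · exact le_iInf₂ fun t ht => Nat.cast_le.2 (Nat.find_min' h ht)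
    · exact (Nat.lt_find_iff h N).symm
  · push Not at h
    exact Or.inl ⟨by simp [hitTime, h], fun N i _ => h i⟩

lemma tsum_ite_lt (n : ℕ) : ∑' t : ℕ, (if t < n then 1 else 0 : ℝ≥0∞) = n := by
  rw [tsum_eq_sum (s := Finset.range n) (fun t ht => if_neg (by simpa using ht)),
    Finset.sum_congr rfl (fun t ht => if_pos (Finset.mem_range.1 ht))]
  simp

lemma two_mul_tsum_tsum_ite_lt (n : ℕ) :
    2 * ∑' s : ℕ, ∑' t : ℕ, (if s + t < n then 1 else 0 : ℝ≥0∞) = (n : ℝ≥0∞) ^ 2 + n := by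
  have h1 : ∀ s, ∑' t : ℕ, (if s + t < n then 1 else 0 : ℝ≥0∞) = ((n - s : ℕ) : ℝ≥0∞) := by
    intro s
    rw [← tsum_ite_lt]
    exact tsum_congr fun t => if_congr (by omega) rfl rfl
  have h2 : ∀ n : ℕ, 2 * ∑ s ∈ Finset.range n, (n - s) = n ^ 2 + n := by
    intro n
    induction n with
    | zero => rfl
    | succ n ih =>
      rw [Finset.sum_range_succ']
      simp only [Nat.add_sub_add_right, mul_add, ih]
      ring_nf
      omega
  simp_rw [h1]
  rw [tsum_eq_sum (s := Finset.range n) (fun s hs => by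
    simp [Nat.sub_eq_zero_of_le (not_lt.1 fun h => hs (Finset.mem_range.2 h))])]
  exact_mod_cast h2 n

lemma hitTime_eq_tsum {J : Type*} (z : J) (ω : ℕ → J) :
    hitTime z ω = ∑' N, (avoid z N).indicator 1 ω := by
  classical
  simp only [Set.indicator_apply, Pi.one_apply]
  rcases hitTime_cases z ω with ⟨h, hN⟩ | ⟨n, h, hN⟩
  · simp [h, hN]
  · simp only [h, hN, tsum_ite_lt]

lemma hitTime_sq_add {J : Type*} (z : J) (ω : ℕ → J) :
    hitTime z ω ^ 2 + hitTime z ω = 2 * ∑' s, ∑' t, (avoid z (s + t)).indicator 1 ω := by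
  classical
  simp only [Set.indicator_apply, Pi.one_apply]
  rcases hitTime_cases z ω with ⟨h, hN⟩ | ⟨n, h, hN⟩
  · simp [h, hN]
  · simp only [h, hN, two_mul_tsum_tsum_ite_lt]

section

variable [MeasurableSingletonClass I]

lemma measurable_indicator_avoid (z : I) (N : ℕ) :
    Measurable ((avoid z N).indicator (1 : (ℕ → I) → ℝ≥0∞)) :=
  measurable_one.indicator (measurableSet_avoid z N)

lemma measurable_hitTime (z : I) : Measurable (hitTime z : (ℕ → I) → ℝ≥0∞) := by
  rw [funext (hitTime_eq_tsum z)]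
  exact Measurable.tsum fun N => measurable_indicator_avoid z N

variable [Countable I]

lemma ET_eq_potential {x z : I} (hx : x ∈ c.branch z) :
    c.ET x z = c.potential (c.depth z) 1 x := by
  rw [ET, potential_eq_tsum]
  simp_rw [hitTime_eq_tsum]
  rw [lintegral_tsum fun N => (measurable_indicator_avoid z N).aemeasurable]
  refine tsum_congr fun N => ?_
  rw [lintegral_indicator_one (measurableSet_avoid z N), c.law_avoid hx]

lemma ET2_add_ET {x z : I} (hx : x ∈ c.branch z) :
    c.ET2 x z + c.ET x z = 2 * c.potential (c.depth z) (c.potential (c.depth z) 1) x := by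
  rw [ET2, ET, ← lintegral_add_right _ (measurable_hitTime z), potential_potential_one]
  simp_rw [hitTime_sq_add]
  rw [lintegral_const_mul _ (Measurable.tsum fun s => Measurable.tsum fun t =>
      measurable_indicator_avoid z (s + t)),
    lintegral_tsum fun s => (Measurable.tsum fun t =>
      measurable_indicator_avoid z (s + t)).aemeasurable]
  congr 1
  refine tsum_congr fun s => ?_
  rw [lintegral_tsum fun t => (measurable_indicator_avoid z (s + t)).aemeasurable]
  refine tsum_congr fun t => ?_
  rw [lintegral_indicator_one (measurableSet_avoid z (s + t)), c.law_avoid hx]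

end

end TreeChain

/-- **Proposition (second moments), child → ancestor**: for `0 ≤ j < n ≤ d(a)`,
`E[(T^{a_j}_{a_n})²] = Σ_{k=j}^{n−1} (2/(μ_{a_k} π(a_k)))·(Σ_{b∈B_{a_k}} π(B_b)²/(μ_b π(b))
 + π(B_{a_k})·E[T^{a_{k+1}}_{a_n}]) − E[T^{a_j}_{a_n}]`, in the equivalent additive form. -/
theorem ET2_iterate_up {I : Type*} [MeasurableSpace I] [Countable I]
    (c : TreeChain I) (a : I) (ha : a ≠ c.root)
    (j n : ℕ) (hjn : j < n) (hn : n ≤ c.depth a) :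
    c.ET2 (c.par^[j] a) (c.par^[n] a) + c.ET (c.par^[j] a) (c.par^[n] a)
      = ∑ k ∈ Finset.Ico j n,
          2 / (c.mu (c.par^[k] a) * c.invm (c.par^[k] a)) *
            ((∑' b : c.branch (c.par^[k] a),
                (c.piSet (c.branch (b : I))) ^ 2 / (c.mu (b : I) * c.invm (b : I))) +
             c.piSet (c.branch (c.par^[k] a)) * c.ET (c.par^[k + 1] a) (c.par^[n] a)) := by
  have := c.measurableSingletonClass ha
  have hmem : ∀ k ≤ n, c.par^[k] a ∈ c.branch (c.par^[n] a) := fun k hk =>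
    ⟨n - k, by rw [← Function.iterate_add_apply, Nat.sub_add_cancel hk]⟩
  rw [c.ET2_add_ET (hmem j hjn.le), c.potential_eq_sum_Ico _ a hjn.le hn, Finset.mul_sum]
  refine Finset.sum_congr rfl fun k hk => ?_
  obtain ⟨-, hkn⟩ := Finset.mem_Ico.1 hk
  rw [c.ET_eq_potential (hmem (k + 1) hkn), TreeChain.slope,
    c.branchSum_potential_one (by rw [c.depth_iterate, c.depth_iterate]; omega),
    ← Function.iterate_succ_apply' c.par]
  simp only [div_eq_mul_inv]
  rw [mul_assoc, mul_comm _⁻¹]
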